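/- arXiv:2102.04602 — 2 statements merged into one kernel-verified Lean document; each statement's English description precedes it below -/
import Mathlib

section
/- Let Θ be a continuous ellipsoid cover of ℝⁿ. Then the function ρ_Θ(x,y) := inf{|θ| : θ ∈ Θ, x, y ∈ θ} is a quasi-distance on ℝⁿ; that is, there exists κ ≥ 1 such that for all x, y, z ∈ ℝⁿ: ρ_Θ(x,y) = 0 if and only if x = y; ρ_Θ(x,y) = ρ_Θ(y,x); and ρ_Θ(x,z) ≤ κ(ρ_Θ(x,y) + ρ_Θ(y,z)). -/
open MeasureTheory Set Pointwise Matrix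

noncomputable section

/-- The ellipsoid `M(𝔹ⁿ) + c` : image of the closed Euclidean unit ball under the
linear map given by the matrix `M`, translated by the center `c`. -/
def ell {n : ℕ} (M : Matrix (Fin n) (Fin n) ℝ) (c : EuclideanSpace ℝ (Fin n)) :
    Set (EuclideanSpace ℝ (Fin n)) :=
  (fun z => Matrix.toEuclideanLin M z + c) '' Metric.closedBall 0 1

/-- Lebesgue measure of a set, as a real number. -/
def volR {n : ℕ} (E : Set (EuclideanSpace ℝ (Fin n))) : ℝ := (volume E).toReal

/-- The (Euclidean) operator norm of a matrix. -/
def opNorm {n : ℕ} (A : Matrix (Fin n) (Fin n) ℝ) : ℝ :=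
  ‖LinearMap.toContinuousLinearMap (Matrix.toEuclideanLin A)‖

/-- A continuous ellipsoid cover of `ℝⁿ`, with ellipsoids
`θ_{x,t} = ell (M x t) x` and parameters `a₁,…,a₆`. -/
structure Cover (n : ℕ) where
  M : EuclideanSpace ℝ (Fin n) → ℝ → Matrix (Fin n) (Fin n) ℝ
  a₁ : ℝ
  a₂ : ℝ
  a₃ : ℝ
  a₄ : ℝ
  a₅ : ℝ
  a₆ : ℝ
  a₁_pos : 0 < a₁
  a₂_pos : 0 < a₂
  a₃_pos : 0 < a₃
  a₄_pos : 0 < a₄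
  a₅_pos : 0 < a₅
  a₆_pos : 0 < a₆
  inv : ∀ x t, IsUnit (M x t)
  vol_lb : ∀ x t, a₁ * 2 ^ (-t) ≤ volR (ell (M x t) x)
  vol_ub : ∀ x t, volR (ell (M x t) x) ≤ a₂ * 2 ^ (-t)
  shape_lb : ∀ x y t s, 0 ≤ s → (ell (M x t) x ∩ ell (M y (t + s)) y).Nonempty →
    a₃ * 2 ^ (-(a₄ * s)) ≤ 1 / opNorm ((M y (t + s))⁻¹ * M x t)
  shape_mid : ∀ x y t s, 0 ≤ s → (ell (M x t) x ∩ ell (M y (t + s)) y).Nonempty →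
    1 / opNorm ((M y (t + s))⁻¹ * M x t) ≤ opNorm ((M x t)⁻¹ * M y (t + s))
  shape_ub : ∀ x y t s, 0 ≤ s → (ell (M x t) x ∩ ell (M y (t + s)) y).Nonempty →
    opNorm ((M x t)⁻¹ * M y (t + s)) ≤ a₅ * 2 ^ (-(a₆ * s))

/-- The quasi-distance induced by a continuous ellipsoid cover:
`ρ_Θ(x,y) = inf {|θ| : θ ∈ Θ, x,y ∈ θ}`. -/
def rhoCover {n : ℕ} (Θ : Cover n) (x y : EuclideanSpace ℝ (Fin n)) : ℝ :=
  sInf {v : ℝ | ∃ z t, x ∈ ell (Θ.M z t) z ∧ y ∈ ell (Θ.M z t) z ∧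
    v = volR (ell (Θ.M z t) z)}

/-- The ball of radius `r` about `x` for the quasi-distance `ρ_Θ`. -/
def ballCover {n : ℕ} (Θ : Cover n) (x : EuclideanSpace ℝ (Fin n)) (r : ℝ) :
    Set (EuclideanSpace ℝ (Fin n)) :=
  {y | rhoCover Θ x y < r}

def gauge' {n : ℕ} (A : Matrix (Fin n) (Fin n) ℝ) (v : EuclideanSpace ℝ (Fin n)) : ℝ :=
  ‖Matrix.toEuclideanLin A⁻¹ v‖

lemma lin_mul {n : ℕ} (A B : Matrix (Fin n) (Fin n) ℝ) (v : EuclideanSpace ℝ (Fin n)) :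
    Matrix.toEuclideanLin (A * B) v = Matrix.toEuclideanLin A (Matrix.toEuclideanLin B v) := by
  simp [Matrix.toLpLin_apply, Matrix.mulVec_mulVec]

lemma lin_one {n : ℕ} (v : EuclideanSpace ℝ (Fin n)) :
    Matrix.toEuclideanLin (1 : Matrix (Fin n) (Fin n) ℝ) v = v := by
  simp [Matrix.toLpLin_apply]

lemma lin_cancel {n : ℕ} {A : Matrix (Fin n) (Fin n) ℝ} (hA : IsUnit A)
    (v : EuclideanSpace ℝ (Fin n)) :
    Matrix.toEuclideanLin A (Matrix.toEuclideanLin A⁻¹ v) = v := by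
  rw [← lin_mul, Matrix.mul_nonsing_inv _ ((Matrix.isUnit_iff_isUnit_det A).1 hA), lin_one]

lemma lin_cancel2 {n : ℕ} {A : Matrix (Fin n) (Fin n) ℝ} (hA : IsUnit A)
    (v : EuclideanSpace ℝ (Fin n)) :
    Matrix.toEuclideanLin A⁻¹ (Matrix.toEuclideanLin A v) = v := by
  rw [← lin_mul, Matrix.nonsing_inv_mul _ ((Matrix.isUnit_iff_isUnit_det A).1 hA), lin_one]

lemma gauge_nonneg' {n : ℕ} (A : Matrix (Fin n) (Fin n) ℝ) (v : EuclideanSpace ℝ (Fin n)) :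
    0 ≤ gauge' A v := norm_nonneg _

lemma mem_ell {n : ℕ} {A : Matrix (Fin n) (Fin n) ℝ} (hA : IsUnit A)
    (c p : EuclideanSpace ℝ (Fin n)) : p ∈ ell A c ↔ gauge' A (p - c) ≤ 1 := by
  constructor
  · rintro ⟨u, hu, rfl⟩
    simpa [gauge', lin_cancel2 hA] using hu
  · intro h
    refine ⟨Matrix.toEuclideanLin A⁻¹ (p - c), by simpa [gauge'] using h, ?_⟩
    simp only [lin_cancel hA, sub_add_cancel]

lemma gauge_le {n : ℕ} (A : Matrix (Fin n) (Fin n) ℝ) {B : Matrix (Fin n) (Fin n) ℝ}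
    (hB : IsUnit B) (v : EuclideanSpace ℝ (Fin n)) :
    gauge' A v ≤ opNorm (A⁻¹ * B) * gauge' B v := by
  have h := (LinearMap.toContinuousLinearMap (Matrix.toEuclideanLin (A⁻¹ * B))).le_opNorm
    (Matrix.toEuclideanLin B⁻¹ v)
  have e : LinearMap.toContinuousLinearMap (Matrix.toEuclideanLin (A⁻¹ * B))
    (Matrix.toEuclideanLin B⁻¹ v) = Matrix.toEuclideanLin A⁻¹ v := by
    rw [LinearMap.coe_toContinuousLinearMap', lin_mul, lin_cancel hB]
  rw [e] at h
  exact h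

lemma gauge_add {n : ℕ} (A : Matrix (Fin n) (Fin n) ℝ) (v w : EuclideanSpace ℝ (Fin n)) :
    gauge' A (v + w) ≤ gauge' A v + gauge' A w := by
  unfold gauge'; rw [map_add]; exact norm_add_le _ _

lemma gauge_sub {n : ℕ} (A : Matrix (Fin n) (Fin n) ℝ) (v w : EuclideanSpace ℝ (Fin n)) :
    gauge' A (v - w) ≤ gauge' A v + gauge' A w := by
  unfold gauge'; rw [map_sub]; exact norm_sub_le _ _

lemma gauge_two {n : ℕ} {A : Matrix (Fin n) (Fin n) ℝ} (hA : IsUnit A)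
    {c p q : EuclideanSpace ℝ (Fin n)} (hp : p ∈ ell A c) (hq : q ∈ ell A c) :
    gauge' A (p - q) ≤ 2 := by
  have := gauge_sub A (p - c) (q - c)
  rw [sub_sub_sub_cancel_right] at this
  linarith [(mem_ell hA c p).1 hp, (mem_ell hA c q).1 hq]

lemma gauge_cover {n : ℕ} (Θ : Cover n) {x y p v : EuclideanSpace ℝ (Fin n)} {t s : ℝ}
    (hs : 0 ≤ s) (h1 : p ∈ ell (Θ.M x t) x) (h2 : p ∈ ell (Θ.M y (t + s)) y) :
    gauge' (Θ.M x t) v ≤ Θ.a₅ * 2 ^ (-(Θ.a₆ * s)) * gauge' (Θ.M y (t + s)) v :=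
  (gauge_le _ (Θ.inv _ _) v).trans
    (mul_le_mul_of_nonneg_right (Θ.shape_ub x y t s hs ⟨p, h1, h2⟩) (gauge_nonneg' _ _))

lemma center_mem {n : ℕ} (Θ : Cover n) (x : EuclideanSpace ℝ (Fin n)) (t : ℝ) :
    x ∈ ell (Θ.M x t) x := by
  rw [mem_ell (Θ.inv _ _)]; simp [gauge']

lemma expo (a C ε : ℝ) (ha : 0 < a) (hε : 0 < ε) :
    ∃ s₀ : ℝ, 0 ≤ s₀ ∧ ∀ s, s₀ ≤ s → C * (2 : ℝ) ^ (-(a * s)) ≤ ε := by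
  have h : Filter.Tendsto (fun s : ℝ => C * (2 : ℝ) ^ (-(a * s))) Filter.atTop (nhds (C * 0)) := by
    apply Filter.Tendsto.const_mul
    apply (tendsto_rpow_atBot_of_base_gt_one 2 one_lt_two).comp
    exact Filter.tendsto_neg_atTop_atBot.comp (Filter.Tendsto.const_mul_atTop ha Filter.tendsto_id)
  rw [mul_zero] at h
  obtain ⟨s, hs⟩ := Filter.eventually_atTop.1 (h.eventually (gt_mem_nhds hε))
  exact ⟨max s 0, le_max_right _ _, fun r hr => (hs r ((le_max_left _ _).trans hr)).le⟩

def rset {n : ℕ} (Θ : Cover n) (x y : EuclideanSpace ℝ (Fin n)) : Set ℝ :=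
  {v : ℝ | ∃ z t, x ∈ ell (Θ.M z t) z ∧ y ∈ ell (Θ.M z t) z ∧
    v = volR (ell (Θ.M z t) z)}

lemma rset_bdd {n : ℕ} (Θ : Cover n) (x y : EuclideanSpace ℝ (Fin n)) :
    BddBelow (rset Θ x y) := by
  refine ⟨0, ?_⟩
  rintro v ⟨z, t, -, -, rfl⟩
  exact ENNReal.toReal_nonneg

lemma rset_ne {n : ℕ} (Θ : Cover n) (x y : EuclideanSpace ℝ (Fin n)) :
    (rset Θ x y).Nonempty := by
  obtain ⟨s, hs, h⟩ := expo Θ.a₆ (Θ.a₅ * gauge' (Θ.M x 0) (y - x)) 1 Θ.a₆_pos one_pos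
  refine ⟨_, x, -s, center_mem Θ x _, ?_, rfl⟩
  rw [mem_ell (Θ.inv _ _)]
  have := gauge_cover Θ (v := y - x) hs (center_mem Θ x (-s)) (center_mem Θ x (-s + s))
  rw [neg_add_cancel] at this
  linarith [h s le_rfl]

lemma rho_nonneg {n : ℕ} (Θ : Cover n) (x y : EuclideanSpace ℝ (Fin n)) :
    0 ≤ rhoCover Θ x y := by
  apply Real.sInf_nonneg
  rintro v ⟨z, t, -, -, rfl⟩
  exact ENNReal.toReal_nonneg

lemma rho_symm {n : ℕ} (Θ : Cover n) (x y : EuclideanSpace ℝ (Fin n)) :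
    rhoCover Θ x y = rhoCover Θ y x := by
  unfold rhoCover
  congr 1
  ext v
  constructor <;> rintro ⟨z, t, h1, h2, h3⟩ <;> exact ⟨z, t, h2, h1, h3⟩

lemma rho_self {n : ℕ} (Θ : Cover n) (x : EuclideanSpace ℝ (Fin n)) :
    rhoCover Θ x x = 0 := by
  apply le_antisymm _ (rho_nonneg Θ x x)
  apply le_of_forall_pos_le_add
  intro ε hε
  obtain ⟨s, hs, h⟩ := expo 1 Θ.a₂ ε one_pos hε
  have h := h s le_rfl
  rw [one_mul] at h
  have : rhoCover Θ x x ≤ volR (ell (Θ.M x s) x) :=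
    csInf_le (rset_bdd Θ x x) ⟨x, s, center_mem Θ x s, center_mem Θ x s, rfl⟩
  linarith [Θ.vol_ub x s]

lemma eq_of_rho {n : ℕ} (Θ : Cover n) (x y : EuclideanSpace ℝ (Fin n))
    (h0 : rhoCover Θ x y = 0) : x = y := by
  have hg : gauge' (Θ.M x 0) (x - y) = 0 := by
    apply le_antisymm _ (gauge_nonneg' _ _)
    apply le_of_forall_pos_le_add
    intro ε hε
    obtain ⟨s, hs, h⟩ := expo Θ.a₆ (Θ.a₅ * 2) ε Θ.a₆_pos hε
    have hpos : 0 < Θ.a₁ * (2 : ℝ) ^ (-s) := mul_pos Θ.a₁_pos (by positivity)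
    have : sInf (rset Θ x y) < Θ.a₁ * (2 : ℝ) ^ (-s) := by
      change rhoCover Θ x y < _
      rw [h0]; exact hpos
    obtain ⟨v, ⟨z, t, hx, hy, rfl⟩, hv⟩ := exists_lt_of_csInf_lt (rset_ne Θ x y) this
    have h1 := lt_of_mul_lt_mul_left ((Θ.vol_lb z t).trans_lt hv) Θ.a₁_pos.le
    rw [Real.rpow_lt_rpow_left_iff one_lt_two] at h1
    have hst : s ≤ t := by linarith
    have hx' : x ∈ ell (Θ.M z (0 + t)) z := by rwa [zero_add]
    have hG := gauge_cover Θ (v := x - y) (hs.trans hst) (center_mem Θ x 0) hx'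
    rw [zero_add t] at hG
    have h2 := gauge_two (Θ.inv z t) hx hy
    have h3 : 0 ≤ Θ.a₅ * (2 : ℝ) ^ (-(Θ.a₆ * t)) :=
      mul_nonneg Θ.a₅_pos.le (by positivity)
    have h4 := mul_le_mul_of_nonneg_left h2 h3
    linarith [h t hst]
  have h5 : Matrix.toEuclideanLin (Θ.M x 0)⁻¹ (x - y) = 0 := norm_eq_zero.1 hg
  have h6 := lin_cancel (Θ.inv x 0) (x - y)
  rw [h5, map_zero] at h6
  exact sub_eq_zero.1 h6.symm

lemma tri_aux {n : ℕ} (Θ : Cover n) {s : ℝ} (hs : 0 ≤ s)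
    (h : Θ.a₅ * (1 + 2 * Θ.a₅) * (2 : ℝ) ^ (-(Θ.a₆ * s)) ≤ 1)
    {x y w z₁ z₂ : EuclideanSpace ℝ (Fin n)} {t₁ t₂ : ℝ} (ht : t₁ ≤ t₂)
    (hx : x ∈ ell (Θ.M z₁ t₁) z₁) (hy : y ∈ ell (Θ.M z₁ t₁) z₁)
    (hy2 : y ∈ ell (Θ.M z₂ t₂) z₂) (hw : w ∈ ell (Θ.M z₂ t₂) z₂) :
    rhoCover Θ x w ≤ Θ.a₂ / Θ.a₁ * (2 : ℝ) ^ s * volR (ell (Θ.M z₁ t₁) z₁) := by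
  have a5 := Θ.a₅_pos
  have hP : 0 < (2 : ℝ) ^ (-(Θ.a₆ * s)) := by positivity
  have key : ∀ v, gauge' (Θ.M z₁ (t₁ - s)) v ≤
      Θ.a₅ * 2 ^ (-(Θ.a₆ * s)) * gauge' (Θ.M z₁ t₁) v := by
    intro v
    have := gauge_cover Θ (v := v) hs (center_mem Θ z₁ (t₁ - s)) (center_mem Θ z₁ (t₁ - s + s))
    rwa [sub_add_cancel] at this
  have key2 : gauge' (Θ.M z₁ t₁) (w - y) ≤ Θ.a₅ * 2 := by
    have hy2' : y ∈ ell (Θ.M z₂ (t₁ + (t₂ - t₁))) z₂ := by rwa [add_sub_cancel]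
    have h1 := gauge_cover Θ (v := w - y) (sub_nonneg.2 ht) hy hy2'
    rw [add_sub_cancel] at h1
    have h2 := gauge_two (Θ.inv z₂ t₂) hw hy2
    have h3 : (2 : ℝ) ^ (-(Θ.a₆ * (t₂ - t₁))) ≤ 1 := by
      apply Real.rpow_le_one_of_one_le_of_nonpos one_le_two
      have := mul_nonneg Θ.a₆_pos.le (sub_nonneg.2 ht)
      linarith
    have h4 : Θ.a₅ * (2 : ℝ) ^ (-(Θ.a₆ * (t₂ - t₁))) ≤ Θ.a₅ := mul_le_of_le_one_right a5.le h3
    exact h1.trans (mul_le_mul h4 h2 (gauge_nonneg' _ _) a5.le)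
  have kx := (mem_ell (Θ.inv _ _) _ _).1 hx
  have ky := (mem_ell (Θ.inv _ _) _ _).1 hy
  have kw : gauge' (Θ.M z₁ t₁) (w - z₁) ≤ 1 + 2 * Θ.a₅ := by
    have := gauge_add (Θ.M z₁ t₁) (w - y) (y - z₁)
    rw [sub_add_sub_cancel] at this
    linarith
  have fin : ∀ p, gauge' (Θ.M z₁ t₁) (p - z₁) ≤ 1 + 2 * Θ.a₅ →
      p ∈ ell (Θ.M z₁ (t₁ - s)) z₁ := by
    intro p hp
    rw [mem_ell (Θ.inv _ _)]
    have := mul_le_mul_of_nonneg_left hp (mul_pos a5 hP).le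
    have := key (p - z₁)
    linarith
  have h1 : rhoCover Θ x w ≤ volR (ell (Θ.M z₁ (t₁ - s)) z₁) :=
    csInf_le (rset_bdd Θ x w) ⟨z₁, t₁ - s, fin x (by linarith), fin w kw, rfl⟩
  have h2 := Θ.vol_ub z₁ (t₁ - s)
  have h3 := Θ.vol_lb z₁ t₁
  have h4 : (2 : ℝ) ^ (-(t₁ - s)) = 2 ^ s * 2 ^ (-t₁) := by
    rw [← Real.rpow_add two_pos]; congr 1; ring
  have a1 := Θ.a₁_pos
  have a2 := Θ.a₂_pos
  calc rhoCover Θ x w ≤ Θ.a₂ * 2 ^ (-(t₁ - s)) := h1.trans h2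
    _ = Θ.a₂ / Θ.a₁ * 2 ^ s * (Θ.a₁ * 2 ^ (-t₁)) := by rw [h4]; field_simp
    _ ≤ _ := mul_le_mul_of_nonneg_left h3 (by positivity)

/-- The function `ρ_Θ` induced by a continuous ellipsoid cover is a quasi-distance
on `ℝⁿ`. -/
theorem stmt7 {n : ℕ} (Θ : Cover n) :
    ∃ κ : ℝ, 1 ≤ κ ∧ ∀ x y z : EuclideanSpace ℝ (Fin n),
      0 ≤ rhoCover Θ x y ∧
      (rhoCover Θ x y = 0 ↔ x = y) ∧
      rhoCover Θ x y = rhoCover Θ y x ∧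
      rhoCover Θ x z ≤ κ * (rhoCover Θ x y + rhoCover Θ y z) := by
  obtain ⟨s, hs, h⟩ := expo Θ.a₆ (Θ.a₅ * (1 + 2 * Θ.a₅)) 1 Θ.a₆_pos one_pos
  have h := h s le_rfl
  set K : ℝ := max 1 (Θ.a₂ / Θ.a₁ * (2 : ℝ) ^ s) with hK
  have hK1 : 1 ≤ K := le_max_left _ _
  have hK2 : Θ.a₂ / Θ.a₁ * (2 : ℝ) ^ s ≤ K := le_max_right _ _
  refine ⟨K, hK1, fun x y z => ⟨rho_nonneg Θ x y, ⟨eq_of_rho Θ x y, ?_⟩, rho_symm Θ x y, ?_⟩⟩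
  · rintro rfl; exact rho_self Θ x
  · have hKpos : 0 < K := by linarith
    have main : ∀ u ∈ rset Θ x y, ∀ v ∈ rset Θ y z, rhoCover Θ x z / K ≤ u + v := by
      rintro u ⟨z₁, t₁, hx, hy, rfl⟩ v ⟨z₂, t₂, hy2, hz, rfl⟩
      rw [div_le_iff₀ hKpos]
      have p1 : 0 ≤ volR (ell (Θ.M z₁ t₁) z₁) := ENNReal.toReal_nonneg
      have p2 : 0 ≤ volR (ell (Θ.M z₂ t₂) z₂) := ENNReal.toReal_nonneg
      have q1 := mul_nonneg hKpos.le p1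
      have q2 := mul_nonneg hKpos.le p2
      rcases le_total t₁ t₂ with ht | ht
      · have := tri_aux Θ hs h ht hx hy hy2 hz
        have := mul_le_mul_of_nonneg_right hK2 p1
        linarith
      · have := tri_aux Θ hs h ht hz hy2 hy hx
        rw [rho_symm] at this
        have := mul_le_mul_of_nonneg_right hK2 p2
        linarith
    have m1 : ∀ u ∈ rset Θ x y, rhoCover Θ x z / K - u ≤ rhoCover Θ y z := by
      intro u hu
      apply le_csInf (rset_ne Θ y z)
      intro v hv
      linarith [main u hu v hv]
    have m2 : rhoCover Θ x z / K - rhoCover Θ y z ≤ rhoCover Θ x y := by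
      apply le_csInf (rset_ne Θ x y)
      intro u hu
      linarith [m1 u hu]
    have m3 : rhoCover Θ x z / K ≤ rhoCover Θ x y + rhoCover Θ y z := by linarith
    rw [div_le_iff₀ hKpos] at m3
    linarith
end
end

section
/- Let ρ be a quasi-distance on ℝⁿ which is quasi-convex with constant Q ≥ 1 and 1-Ahlfors-regular, and for each x ∈ ℝⁿ, r > 0 let ξ_x^r be an ellipsoid centered at x with ξ_x^r ⊆ B_ρ(x,r) ⊆ Q·ξ_x^r. Define θ_{x,t} := ξ_x^{2^{−t}} for x ∈ ℝⁿ, t ∈ ℝ. Then Ξ_ρ = {θ_{x,t} : x ∈ ℝⁿ, t ∈ ℝ} is a continuous ellipsoid cover of ℝⁿ: there exist positive constants a₁, …, a₆ such that a₁2^{−t} ≤ |θ_{x,t}| ≤ a₂2^{−t} for all x, t, and for all x, y ∈ ℝⁿ, t ∈ ℝ, s ≥ 0 with θ_{x,t} ∩ θ_{y,t+s} ≠ ∅ one has a₃2^{−a₄s} ≤ 1/‖(M_{y,t+s})⁻¹M_{x,t}‖ ≤ ‖(M_{x,t})⁻¹M_{y,t+s}‖ ≤ a₅2^{−a₆s},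 where θ_{x,t} = M_{x,t}(𝔹ⁿ)+x. -/
open MeasureTheory Set Pointwise Matrix

noncomputable section

/-- The ball of a quasi-distance `ρ`. -/
def ballQ {n : ℕ} (ρ : EuclideanSpace ℝ (Fin n) → EuclideanSpace ℝ (Fin n) → ℝ)
    (x : EuclideanSpace ℝ (Fin n)) (r : ℝ) : Set (EuclideanSpace ℝ (Fin n)) :=
  {y | ρ x y < r}


lemma opNorm_nonneg' {n : ℕ} (A : Matrix (Fin n) (Fin n) ℝ) : 0 ≤ opNorm A := norm_nonneg _

lemma opNorm_apply {n : ℕ} (A : Matrix (Fin n) (Fin n) ℝ) (v : EuclideanSpace ℝ (Fin n)) :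
    ‖Matrix.toEuclideanLin A v‖ ≤ opNorm A * ‖v‖ :=
  (LinearMap.toContinuousLinearMap (Matrix.toEuclideanLin A)).le_opNorm v

lemma opNorm_mul' {n : ℕ} (A B : Matrix (Fin n) (Fin n) ℝ) :
    opNorm (A * B) ≤ opNorm A * opNorm B := by
  refine ContinuousLinearMap.opNorm_le_bound _ (mul_nonneg (opNorm_nonneg' _) (opNorm_nonneg' _)) ?_
  intro v
  have : (LinearMap.toContinuousLinearMap (Matrix.toEuclideanLin (A * B))) v
      = Matrix.toEuclideanLin A (Matrix.toEuclideanLin B v) := by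
    simp [Matrix.toEuclideanLin]
  rw [this]
  refine (opNorm_apply _ _).trans ?_
  rw [mul_assoc]
  exact mul_le_mul_of_nonneg_left (opNorm_apply _ _) (opNorm_nonneg' _)

lemma opNorm_one' {n : ℕ} (hn : 0 < n) : opNorm (1 : Matrix (Fin n) (Fin n) ℝ) = 1 := by
  have : Nonempty (Fin n) := ⟨⟨0, hn⟩⟩
  unfold opNorm
  have : LinearMap.toContinuousLinearMap (Matrix.toEuclideanLin (1 : Matrix (Fin n) (Fin n) ℝ))
      = ContinuousLinearMap.id ℝ _ := by
    ext v; simp [Matrix.toEuclideanLin]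
  rw [this]
  exact ContinuousLinearMap.norm_id

lemma entry_le_opNorm {n : ℕ} (A : Matrix (Fin n) (Fin n) ℝ) (i j : Fin n) :
    |A i j| ≤ opNorm A := by
  have h := opNorm_apply A (EuclideanSpace.single j 1)
  have h2 := PiLp.norm_apply_le (Matrix.toEuclideanLin A (EuclideanSpace.single j 1)) i
  have h3 : (Matrix.toEuclideanLin A (EuclideanSpace.single j 1)) i = A i j := by
    simp [Matrix.toEuclideanLin]
  rw [h3, Real.norm_eq_abs] at h2
  simpa using h2.trans h

lemma opNorm_entry {n : ℕ} (A : Matrix (Fin n) (Fin n) ℝ) (c : ℝ) (hc : 0 ≤ c)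
    (h : ∀ i j, |A i j| ≤ c) : opNorm A ≤ n * n * c := by
  refine ContinuousLinearMap.opNorm_le_bound _ (by positivity) ?_
  intro v
  have hv : ∀ i, ‖(Matrix.toEuclideanLin A v) i‖ ≤ n * c * ‖v‖ := by
    intro i
    have : (Matrix.toEuclideanLin A v) i = ∑ j, A i j * v j := by
      simp [Matrix.toEuclideanLin, Matrix.mulVec, dotProduct]
    rw [this]
    calc ‖∑ j, A i j * v j‖ ≤ ∑ j, ‖A i j * v j‖ := norm_sum_le _ _
      _ ≤ ∑ _j : Fin n, c * ‖v‖ := by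
        refine Finset.sum_le_sum fun j _ => ?_
        rw [norm_mul]
        exact mul_le_mul (h i j) (PiLp.norm_apply_le v j) (norm_nonneg _) hc
      _ = n * c * ‖v‖ := by simp [mul_assoc]
  set w := Matrix.toEuclideanLin A v with hw
  change ‖w‖ ≤ _
  have hs : w = ∑ i, EuclideanSpace.single i (w i) := by
    ext k
    simp [Finset.sum_apply, Pi.single_apply]
  calc ‖w‖ = ‖∑ i, EuclideanSpace.single i (w i)‖ := by rw [← hs]
    _ ≤ ∑ i, ‖EuclideanSpace.single i (w i)‖ := norm_sum_le _ _
    _ ≤ ∑ _i : Fin n, n * c * ‖v‖ := by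
      refine Finset.sum_le_sum fun i _ => ?_
      simpa using hv i
    _ = n * n * c * ‖v‖ := by simp; ring

lemma opNorm_inv_le {n : ℕ} (A : Matrix (Fin n) (Fin n) ℝ) (q d : ℝ) (hq : 1 ≤ q) (hd : 0 < d)
    (hA : opNorm A ≤ q) (hdet : d ≤ |A.det|) :
    opNorm A⁻¹ ≤ n * n * ((n.factorial : ℝ) * q ^ n) / d := by
  have := opNorm_entry A⁻¹ ((n.factorial : ℝ) * q ^ n / d) (by positivity) ?_
  · calc _ ≤ _ := this
      _ = _ := by ring
  intro i j
  have hadj : |A.adjugate i j| ≤ (n.factorial : ℝ) * q ^ n := by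
    rw [Matrix.adjugate_apply]
    have := Matrix.det_le (A := A.updateRow j (Pi.single i 1)) (abv := AbsoluteValue.abs) (x := q) ?_
    · simpa using this
    intro k l
    rw [AbsoluteValue.abs_apply, Matrix.updateRow_apply]
    split_ifs
    · rw [Pi.single_apply]
      split_ifs
      · simpa using hq
      · simp; linarith
    · exact (entry_le_opNorm A k l).trans hA
  rw [Matrix.inv_def, Matrix.smul_apply, smul_eq_mul, abs_mul, Ring.inverse_eq_inv', abs_inv,
    mul_comm, ← div_eq_mul_inv]
  exact div_le_div₀ (by positivity) hadj hd hdet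

lemma volume_ell {n : ℕ} (M : Matrix (Fin n) (Fin n) ℝ) (c : EuclideanSpace ℝ (Fin n)) :
    volume (ell M c) = ENNReal.ofReal |M.det| *
      volume (Metric.closedBall (0 : EuclideanSpace ℝ (Fin n)) 1) := by
  have : ell M c = (fun z => z + c) '' (Matrix.toEuclideanLin M '' Metric.closedBall 0 1) := by
    rw [Set.image_image]; rfl
  rw [this, Set.image_add_right, measure_preimage_add_right,
    MeasureTheory.Measure.addHaar_image_linearMap, LinearMap.det_toLpLin]

lemma volR_ell {n : ℕ} (M : Matrix (Fin n) (Fin n) ℝ) (c : EuclideanSpace ℝ (Fin n)) :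
    volR (ell M c) = |M.det| * volR (Metric.closedBall (0 : EuclideanSpace ℝ (Fin n)) 1) := by
  unfold volR
  rw [volume_ell, ENNReal.toReal_mul, ENNReal.toReal_ofReal (abs_nonneg _)]

lemma volume_ell_ne_top {n : ℕ} (M : Matrix (Fin n) (Fin n) ℝ) (c : EuclideanSpace ℝ (Fin n)) :
    volume (ell M c) ≠ ⊤ := by
  rw [volume_ell]
  exact ENNReal.mul_ne_top ENNReal.ofReal_ne_top measure_closedBall_lt_top.ne

lemma volR_unit_pos {n : ℕ} :
    0 < volR (Metric.closedBall (0 : EuclideanSpace ℝ (Fin n)) 1) :=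
  ENNReal.toReal_pos (Metric.measure_closedBall_pos _ _ one_pos).ne' measure_closedBall_lt_top.ne

lemma mem_ell_smul {n : ℕ} (q : ℝ) (hq : 0 ≤ q) (N : Matrix (Fin n) (Fin n) ℝ)
    (c w : EuclideanSpace ℝ (Fin n)) (h : w ∈ ell (q • N) c) :
    ∃ u, ‖u‖ ≤ q ∧ w = Matrix.toEuclideanLin N u + c := by
  obtain ⟨z, hz, rfl⟩ := h
  refine ⟨q • z, ?_, by simp⟩
  rw [norm_smul, Real.norm_of_nonneg hq]
  have : ‖z‖ ≤ 1 := by simpa using hz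
  nlinarith

/-- comparison of two ellipsoids -/
lemma opNorm_of_incl {n : ℕ} (M N : Matrix (Fin n) (Fin n) ℝ) (hN : IsUnit N)
    (q μ : ℝ) (hq : 0 ≤ q) (hμ : 0 < μ) (c c' : EuclideanSpace ℝ (Fin n))
    (h : ∀ u, ‖u‖ ≤ 1 → c + μ • Matrix.toEuclideanLin M u ∈ ell (q • N) c') :
    opNorm (N⁻¹ * M) ≤ q / μ := by
  have hdet : IsUnit N.det := (Matrix.isUnit_iff_isUnit_det N).1 hN
  have key : ∀ u, ‖u‖ ≤ 1 → ‖Matrix.toEuclideanLin (N⁻¹ * M) u‖ ≤ q / μ := by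
    intro u hu
    obtain ⟨a, ha, ha'⟩ := mem_ell_smul q hq N _ _ (h u hu)
    obtain ⟨b, hb, hb'⟩ := mem_ell_smul q hq N _ _ (h (-u) (by simpa using hu))
    have e : (2 * μ) • Matrix.toEuclideanLin M u = Matrix.toEuclideanLin N (a - b) := by
      have : (c + μ • Matrix.toEuclideanLin M u) - (c + μ • Matrix.toEuclideanLin M (-u))
        = Matrix.toEuclideanLin N (a - b) := by
        rw [ha', hb', map_sub]; abel
      rw [← this, map_neg]
      module
    have e2 : (2 * μ) • Matrix.toEuclideanLin (N⁻¹ * M) u = a - b := by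
      have h1 : Matrix.toEuclideanLin (N⁻¹ * M) u
        = Matrix.toEuclideanLin N⁻¹ (Matrix.toEuclideanLin M u) := by simp [Matrix.toEuclideanLin]
      have h2 : Matrix.toEuclideanLin N⁻¹ (Matrix.toEuclideanLin N (a - b)) = a - b := by
        have : Matrix.toEuclideanLin N⁻¹ (Matrix.toEuclideanLin N (a - b))
          = Matrix.toEuclideanLin (N⁻¹ * N) (a - b) := by
          rw [Matrix.toEuclideanLin, Matrix.toLpLin_mul_same]; rfl
        rw [this, Matrix.nonsing_inv_mul _ hdet]
        simp [Matrix.toEuclideanLin]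
      rw [h1, ← map_smul, e, h2]
    have e3 : 2 * μ * ‖Matrix.toEuclideanLin (N⁻¹ * M) u‖ ≤ 2 * q := by
      have := congrArg norm e2
      rw [norm_smul, Real.norm_of_nonneg (by positivity)] at this
      rw [this]
      linarith [norm_sub_le a b]
    rw [le_div_iff₀ hμ]
    linarith
  refine ContinuousLinearMap.opNorm_le_of_unit_norm (𝕜 := ℝ) (by positivity) ?_
  intro u hu
  exact key u hu.le

lemma one_le_opNorm_inv_mul {n : ℕ} (hn : 0 < n) (M N : Matrix (Fin n) (Fin n) ℝ)
    (hM : IsUnit M) (hN : IsUnit N) :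
    1 ≤ opNorm (M⁻¹ * N) * opNorm (N⁻¹ * M) := by
  have hM' : IsUnit M.det := (Matrix.isUnit_iff_isUnit_det M).1 hM
  have hN' : IsUnit N.det := (Matrix.isUnit_iff_isUnit_det N).1 hN
  have : (M⁻¹ * N) * (N⁻¹ * M) = 1 := by
    rw [Matrix.mul_assoc, ← Matrix.mul_assoc N, Matrix.mul_nonsing_inv _ hN', Matrix.one_mul,
      Matrix.nonsing_inv_mul _ hM']
  rw [← opNorm_one' hn, ← this]
  exact opNorm_mul' _ _

set_option maxHeartbeats 1000000 in
/-- For a quasi-convex, 1-Ahlfors-regular quasi-distance `ρ` with associated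
ellipsoids `ξ_x^r`, the family `θ_{x,t} := ξ_x^{2^{-t}}` is a continuous ellipsoid
cover of `ℝⁿ`: it satisfies the volume condition and the shape condition. -/
theorem stmt15 {n : ℕ}
    (ρ : EuclideanSpace ℝ (Fin n) → EuclideanSpace ℝ (Fin n) → ℝ)
    (hnn : ∀ x y, 0 ≤ ρ x y)
    (hzero : ∀ x y, ρ x y = 0 ↔ x = y)
    (hsymm : ∀ x y, ρ x y = ρ y x)
    (κ : ℝ) (hκ : 1 ≤ κ)
    (htri : ∀ x y z, ρ x z ≤ κ * (ρ x y + ρ y z))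
    (Q : ℝ) (hQ : 1 ≤ Q)
    (ξM : EuclideanSpace ℝ (Fin n) → ℝ → Matrix (Fin n) (Fin n) ℝ)
    (hξ_inv : ∀ x r, 0 < r → IsUnit (ξM x r))
    (hξ_sub : ∀ x r, 0 < r → ell (ξM x r) x ⊆ ballQ ρ x r)
    (hξ_sup : ∀ x r, 0 < r → ballQ ρ x r ⊆ ell (Q • ξM x r) x)
    (c₁ : ℝ) (hc₁ : 1 ≤ c₁)
    (hAhl : ∀ x r, 0 < r → r / c₁ ≤ volR (ballQ ρ x r) ∧ volR (ballQ ρ x r) ≤ c₁ * r)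
 :
    ∃ a₁ a₂ a₃ a₄ a₅ a₆ : ℝ,
      0 < a₁ ∧ 0 < a₂ ∧ 0 < a₃ ∧ 0 < a₄ ∧ 0 < a₅ ∧ 0 < a₆ ∧
      (∀ (x : EuclideanSpace ℝ (Fin n)) (t : ℝ),
        a₁ * 2 ^ (-t) ≤ volR (ell (ξM x (2 ^ (-t))) x) ∧
        volR (ell (ξM x (2 ^ (-t))) x) ≤ a₂ * 2 ^ (-t)) ∧
      (∀ (x y : EuclideanSpace ℝ (Fin n)) (t s : ℝ), 0 ≤ s →
        (ell (ξM x (2 ^ (-t))) x ∩ ell (ξM y (2 ^ (-(t + s)))) y).Nonempty →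
        a₃ * 2 ^ (-(a₄ * s)) ≤ 1 / opNorm ((ξM y (2 ^ (-(t + s))))⁻¹ * ξM x (2 ^ (-t))) ∧
        1 / opNorm ((ξM y (2 ^ (-(t + s))))⁻¹ * ξM x (2 ^ (-t)))
          ≤ opNorm ((ξM x (2 ^ (-t)))⁻¹ * ξM y (2 ^ (-(t + s)))) ∧
        opNorm ((ξM x (2 ^ (-t)))⁻¹ * ξM y (2 ^ (-(t + s)))) ≤ a₅ * 2 ^ (-(a₆ * s))) := by
  have hκ0 : 0 < κ := by linarith
  have hQ0 : 0 < Q := by linarith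
  have hc0 : 0 < c₁ := by linarith
  have hlt : ∀ x y z A B, ρ x y < A → ρ y z < B → ρ x z < κ * (A + B) := by
    intro x y z A B h1 h2
    exact (htri x y z).trans_lt (mul_lt_mul_of_pos_left (add_lt_add h1 h2) hκ0)
  have hself : ∀ x, ρ x x = 0 := fun x => (hzero x x).2 rfl
  -- dimension is positive
  have hn : 0 < n := by
    rcases Nat.eq_zero_or_pos n with h0 | h
    · exfalso
      subst h0
      have hu : ∀ r : ℝ, 0 < r →
          ballQ ρ (0 : EuclideanSpace ℝ (Fin 0)) r = Set.univ := by
        intro r hr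
        ext y
        have : (0 : EuclideanSpace ℝ (Fin 0)) = y := Subsingleton.elim _ _
        simp [ballQ, ← this, hself, hr]
      set V := volR (Set.univ : Set (EuclideanSpace ℝ (Fin 0))) with hV
      have hV0 : 0 ≤ V := ENNReal.toReal_nonneg
      have hr : 0 < c₁ * (V + 1) := by positivity
      have := (hAhl 0 _ hr).1
      rw [hu _ hr, ← hV, mul_div_cancel_left₀ _ hc0.ne'] at this
      linarith
    · exact h
  set V := volR (Metric.closedBall (0 : EuclideanSpace ℝ (Fin n)) 1) with hV
  have hV0 : 0 < V := volR_unit_pos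
  -- volume bounds
  have hvol1 : ∀ x r, 0 < r → volR (ell (ξM x r) x) ≤ c₁ * r := by
    intro x r hr
    refine le_trans ?_ (hAhl x r hr).2
    refine ENNReal.toReal_mono ?_ (measure_mono (hξ_sub x r hr))
    exact ne_top_of_le_ne_top (volume_ell_ne_top _ _) (measure_mono (hξ_sup x r hr))
  have hvol2 : ∀ x r, 0 < r → 1 / (c₁ * Q ^ n) * r ≤ volR (ell (ξM x r) x) := by
    intro x r hr
    have h1 : volR (ballQ ρ x r) ≤ volR (ell (Q • ξM x r) x) :=
      ENNReal.toReal_mono (volume_ell_ne_top _ _) (measure_mono (hξ_sup x r hr))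
    have h2 : volR (ell (Q • ξM x r) x) = Q ^ n * volR (ell (ξM x r) x) := by
      rw [volR_ell, volR_ell, Matrix.det_smul, abs_mul, abs_of_nonneg (by positivity),
        Fintype.card_fin, mul_assoc]
    have h3 := (hAhl x r hr).1
    have h4 : r / c₁ ≤ Q ^ n * volR (ell (ξM x r) x) := by linarith
    have : 1 / (c₁ * Q ^ n) * r = r / c₁ / Q ^ n := by field_simp
    rw [this, div_le_iff₀ (by positivity)]
    linarith
  have hdetU : ∀ x r, 0 < r → IsUnit (ξM x r).det := fun x r hr =>
    (Matrix.isUnit_iff_isUnit_det _).1 (hξ_inv x r hr)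
  -- comparison with same centre
  set C := (n : ℝ) * n * ((n.factorial : ℝ) * Q ^ n) * (c₁ ^ 2 * Q ^ n) with hC
  have hC0 : 0 < C := by
    have : (0 : ℝ) < n := by exact_mod_cast hn
    positivity
  have hcmp : ∀ x r₁ r₂, 0 < r₁ → r₁ ≤ r₂ →
      opNorm ((ξM x r₁)⁻¹ * ξM x r₂) ≤ C * (r₂ / r₁) := by
    intro x r₁ r₂ h1 h12
    have h2 : 0 < r₂ := by linarith
    have hA : opNorm ((ξM x r₂)⁻¹ * ξM x r₁) ≤ Q := by
      have := opNorm_of_incl (ξM x r₁) (ξM x r₂) (hξ_inv x r₂ h2) Q 1 hQ0.le one_pos x x ?_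
      · simpa using this
      intro u hu
      apply hξ_sup x r₂ h2
      have : ρ x (x + (1 : ℝ) • Matrix.toEuclideanLin (ξM x r₁) u) < r₁ := by
        apply hξ_sub x r₁ h1
        exact ⟨u, by simpa using hu, by simp [add_comm]⟩
      exact lt_of_lt_of_le this h12
    have hd : r₁ / r₂ / (c₁ ^ 2 * Q ^ n) ≤ |((ξM x r₂)⁻¹ * ξM x r₁).det| := by
      have e1 := hvol2 x r₁ h1
      have e2 := hvol1 x r₂ h2
      rw [volR_ell, ← hV] at e1 e2
      rw [Matrix.det_mul, Matrix.det_nonsing_inv, Ring.inverse_eq_inv', abs_mul, abs_inv]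
      have p2 : 0 < |(ξM x r₂).det| := abs_pos.2 (hdetU x r₂ h2).ne_zero
      rw [inv_mul_eq_div, le_div_iff₀ p2]
      have e3 : |(ξM x r₂).det| ≤ c₁ * r₂ / V := by rwa [le_div_iff₀ hV0]
      have e4 : 1 / (c₁ * Q ^ n) * r₁ / V ≤ |(ξM x r₁).det| := by rwa [div_le_iff₀ hV0]
      refine le_trans ?_ e4
      calc r₁ / r₂ / (c₁ ^ 2 * Q ^ n) * |(ξM x r₂).det|
          ≤ r₁ / r₂ / (c₁ ^ 2 * Q ^ n) * (c₁ * r₂ / V) :=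
            mul_le_mul_of_nonneg_left e3 (by positivity)
        _ = 1 / (c₁ * Q ^ n) * r₁ / V := by field_simp
    have := opNorm_inv_le _ Q _ hQ (by positivity) hA hd
    rw [Matrix.mul_inv_rev, Matrix.nonsing_inv_nonsing_inv _ (hdetU x r₂ h2)] at this
    refine this.trans (le_of_eq ?_)
    rw [hC]
    field_simp
  -- chain step
  set μ := 1 + 1 / Q with hμ
  have hμ1 : 1 < μ := by
    have : 0 < 1 / Q := by positivity
    linarith
  have hstep : ∀ y v R, 0 < R → ρ y (y + v) < R → ρ y (y + μ • v) < 2 * κ * R := by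
    intro y v R hR h
    have h1 : y ∈ ballQ ρ (y + v) R := by
      change ρ (y + v) y < R
      rwa [hsymm]
    obtain ⟨z, hz, hz'⟩ := hξ_sup _ _ hR h1
    have h2 : y + μ • v ∈ ell (ξM (y + v) R) (y + v) := by
      refine ⟨-z, by simpa using hz, ?_⟩
      have h3 : Q • Matrix.toEuclideanLin (ξM (y + v) R) z = - v := by
        have : Q • Matrix.toEuclideanLin (ξM (y + v) R) z + (y + v) = y := by
          simpa using hz'
        have h5 : Q • Matrix.toEuclideanLin (ξM (y + v) R) z
          = (Q • Matrix.toEuclideanLin (ξM (y + v) R) z + (y + v)) - (y + v) := by abel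
        rw [h5, this]; abel
      have h4 : Matrix.toEuclideanLin (ξM (y + v) R) z = - ((1 / Q) • v) := by
        rw [← smul_neg, ← h3, smul_smul, one_div, inv_mul_cancel₀ hQ0.ne', one_smul]
      change Matrix.toEuclideanLin (ξM (y + v) R) (-z) + (y + v) = _
      rw [map_neg, h4, hμ]
      module
    have h3 : ρ (y + v) (y + μ • v) < R := hξ_sub _ _ hR h2
    have := hlt _ _ _ _ _ h h3
    calc _ < _ := this
      _ = _ := by ring
  have hchain : ∀ (k : ℕ) y v R, 0 < R → ρ y (y + v) < R →
      ρ y (y + μ ^ k • v) < (2 * κ) ^ k * R := by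
    intro k
    induction k with
    | zero => intro y v R _ h; simpa using h
    | succ k ih =>
      intro y v R hR h
      have := hstep y (μ ^ k • v) _ (by positivity) (ih y v R hR h)
      rw [smul_smul, ← pow_succ'] at this
      calc _ < _ := this
        _ = _ := by ring
  set K := κ * (2 * κ + 1) with hK
  have hK1 : 1 ≤ K := by nlinarith
  have hK0 : 0 < K := by linarith
  set L := Real.logb 2 (2 * κ) with hL
  have hL1 : 0 < L := Real.logb_pos (by norm_num) (by linarith)
  set a := Real.logb 2 μ / L with ha
  have ha0 : 0 < a := div_pos (Real.logb_pos (by norm_num) hμ1) hL1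
  refine ⟨1 / (c₁ * Q ^ n), c₁, 1 / (C * K * Q), 1, C * K * Q * μ, a,
    by positivity, by positivity, by positivity, by positivity, by positivity, ha0, ?_, ?_⟩
  · intro x t
    exact ⟨hvol2 x _ (by positivity), hvol1 x _ (by positivity)⟩
  intro x y t s hs hne
  set r : ℝ := 2 ^ (-t) with hr
  set r' : ℝ := 2 ^ (-(t + s)) with hr'
  have hr0 : 0 < r := by positivity
  have hr0' : 0 < r' := by positivity
  have hrr : r = 2 ^ s * r' := by
    rw [hr, hr', ← Real.rpow_add (by norm_num)]
    congr 1; ring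
  have hle : r' ≤ r := by
    rw [hrr]
    exact le_mul_of_one_le_left hr0'.le (Real.one_le_rpow (by norm_num) hs)
  obtain ⟨z, hzx, hzy⟩ := hne
  have hxz : ρ x z < r := hξ_sub x r hr0 hzx
  have hyz : ρ y z < r' := hξ_sub y r' hr0' hzy
  have hxy : ρ x y < 2 * κ * r := by
    rw [hsymm] at hyz
    have := hlt _ _ _ _ _ hxz (hyz.trans_le hle)
    calc _ < _ := this
      _ = _ := by ring
  have hKr : r ≤ K * r := le_mul_of_one_le_left hr0.le hK1
  have hKr0 : 0 < K * r := by positivity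
  have hMx := hξ_inv x r hr0
  have hMy := hξ_inv y r' hr0'
  have hfac : ∀ A B D : Matrix (Fin n) (Fin n) ℝ, IsUnit B →
      opNorm (A⁻¹ * D) ≤ opNorm (A⁻¹ * B) * opNorm (B⁻¹ * D) := by
    intro A B D hB
    have : A⁻¹ * D = (A⁻¹ * B) * (B⁻¹ * D) := by
      rw [Matrix.mul_assoc, ← Matrix.mul_assoc B,
        Matrix.mul_nonsing_inv _ ((Matrix.isUnit_iff_isUnit_det B).1 hB), Matrix.one_mul]
    rw [this]
    exact opNorm_mul' _ _
  have hone := one_le_opNorm_inv_mul hn _ _ hMx hMy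
  have hp : 0 < opNorm ((ξM y r')⁻¹ * ξM x r) := by
    rcases (opNorm_nonneg' ((ξM y r')⁻¹ * ξM x r)).lt_or_eq with h | h
    · exact h
    · rw [← h] at hone; norm_num at hone
  refine ⟨?_, ?_, ?_⟩
  · have h1 : opNorm ((ξM y (K * r))⁻¹ * ξM x r) ≤ Q := by
      have := opNorm_of_incl (ξM x r) (ξM y (K * r)) (hξ_inv _ _ hKr0) Q 1 hQ0.le one_pos x y ?_
      · simpa using this
      intro u hu
      apply hξ_sup y _ hKr0
      have h2 : ρ x (x + (1 : ℝ) • Matrix.toEuclideanLin (ξM x r) u) < r := by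
        apply hξ_sub x r hr0
        exact ⟨u, by simpa using hu, by simp [add_comm]⟩
      have h3 := hlt _ _ _ _ _ (by rw [hsymm]; exact hxy : ρ y x < 2 * κ * r) h2
      change _ < K * r
      calc _ < _ := h3
        _ = _ := by rw [hK]; ring
    have h2 := hcmp y r' (K * r) hr0' (hle.trans hKr)
    have h3 : K * r / r' = K * 2 ^ s := by
      rw [hrr]; field_simp
    rw [h3] at h2
    have h4 : opNorm ((ξM y r')⁻¹ * ξM x r) ≤ C * K * Q * 2 ^ s := by
      calc _ ≤ _ := hfac (ξM y r') (ξM y (K * r)) (ξM x r) (hξ_inv _ _ hKr0)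
        _ ≤ (C * (K * 2 ^ s)) * Q := mul_le_mul h2 h1 (opNorm_nonneg' _) (by positivity)
        _ = _ := by ring
    have h5 : 1 / (C * K * Q) * 2 ^ (-(1 * s)) = 1 / (C * K * Q * (2 : ℝ) ^ s) := by
      rw [one_mul, Real.rpow_neg (by norm_num)]; field_simp
    rw [h5]
    exact one_div_le_one_div_of_le hp h4
  · rw [div_le_iff₀ hp]; exact hone
  · set k := ⌊s / L⌋₊ with hk
    have hk1 : (k : ℝ) ≤ s / L := Nat.floor_le (by positivity)
    have hk2 : s / L < k + 1 := Nat.lt_floor_add_one _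
    have hpow : (2 * κ) ^ k * r' ≤ r := by
      rw [hrr]
      refine mul_le_mul_of_nonneg_right ?_ hr0'.le
      have e : (2 * κ : ℝ) = 2 ^ L := (Real.rpow_logb (by norm_num) (by norm_num) (by positivity)).symm
      rw [e, ← Real.rpow_natCast, ← Real.rpow_mul (by norm_num)]
      refine Real.rpow_le_rpow_of_exponent_le (by norm_num) ?_
      rw [le_div_iff₀ hL1] at hk1
      linarith
    have h1 : opNorm ((ξM x (K * r))⁻¹ * ξM y r') ≤ Q / μ ^ k := by
      refine opNorm_of_incl (ξM y r') (ξM x (K * r)) (hξ_inv _ _ hKr0) Q (μ ^ k) hQ0.le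
        (by positivity) y x ?_
      intro u hu
      apply hξ_sup x _ hKr0
      have h2 : ρ y (y + Matrix.toEuclideanLin (ξM y r') u) < r' := by
        apply hξ_sub y r' hr0'
        exact ⟨u, by simpa using hu, by simp [add_comm]⟩
      have h4 := (hchain k y _ r' hr0' h2).trans_le hpow
      have h3 := hlt _ _ _ _ _ hxy h4
      change _ < K * r
      calc _ < _ := h3
        _ = _ := by rw [hK]; ring
    have h2 := hcmp x r (K * r) hr0 hKr
    rw [mul_div_cancel_right₀ _ hr0.ne'] at h2
    have h3 : 1 / μ ^ k ≤ μ * 2 ^ (-(a * s)) := by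
      have e : (μ : ℝ) = 2 ^ (Real.logb 2 μ) :=
        (Real.rpow_logb (by norm_num) (by norm_num) (by positivity)).symm
      have e1 : (2 : ℝ) ^ (a * s) ≤ μ ^ (k + 1) := by
        have : (2 : ℝ) ^ (a * s) = μ ^ (s / L) := by
          conv_rhs => rw [e]
          rw [← Real.rpow_mul (by norm_num), ha]
          congr 1; ring
        rw [this, ← Real.rpow_natCast]
        refine Real.rpow_le_rpow_of_exponent_le hμ1.le ?_
        push_cast; linarith
      rw [Real.rpow_neg (by norm_num), ← div_eq_mul_inv, div_le_div_iff₀ (by positivity) (by positivity)]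
      rw [pow_succ'] at e1
      linarith
    calc _ ≤ _ := hfac (ξM x r) (ξM x (K * r)) (ξM y r') (hξ_inv _ _ hKr0)
      _ ≤ (C * K) * (Q / μ ^ k) := mul_le_mul h2 h1 (opNorm_nonneg' _) (by positivity)
      _ = C * K * Q * (1 / μ ^ k) := by ring
      _ ≤ C * K * Q * (μ * 2 ^ (-(a * s))) := mul_le_mul_of_nonneg_left h3 (by positivity)
      _ = _ := by ring
end
end
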